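/- Let ν ≥ 0 and let θ : (0, ∞) → ℝ be three times continuously differentiable with θ'(x) > 0 and θ(x) > −π/2 for all x > 0, satisfying V_θ(x) = 1 − (ν² − 1/4)/x² for all x > 0, and satisfying the asymptotics θ(x) − (x − (π/4)(2ν + 1) + (4ν² − 1)/(8x) + (4ν² − 1)(4ν² − 25)/(384x³)) = O(x⁻⁵) as x → +∞. Then for every x > ν, max{θlo_ν(x), −π/2} < θ(x) < θup_ν(x). -/

import Mathlib

/-- The potential `V_f` associated with a function `f` via Liouville's transformation. -/
noncomputable def potential (f : ℝ → ℝ) (x : ℝ) : ℝ :=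
  (deriv f x) ^ 2 + (1 / 2) * (deriv (deriv (deriv f)) x / deriv f x)
    - (3 / 4) * (deriv (deriv f) x / deriv f x) ^ 2

/-- The upper bound for the Bessel phase function:
`θup_ν(x) := √(x² − ν²) − ν·arccos(ν/x) − π/4`. -/
noncomputable def thetaUp (ν x : ℝ) : ℝ :=
  Real.sqrt (x ^ 2 - ν ^ 2) - ν * Real.arccos (ν / x) - Real.pi / 4

/-- The lower bound for the Bessel phase function:
`θlo_ν(x) := √(x² − ν²) − ν·arccos(ν/x) − π/4 − (3x² + 2ν²)/(24(x² − ν²)^{3/2})`. -/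
noncomputable def thetaLo (ν x : ℝ) : ℝ :=
  thetaUp ν x - (3 * x ^ 2 + 2 * ν ^ 2) / (24 * Real.sqrt (x ^ 2 - ν ^ 2) ^ 3)

open Real Set Filter Topology

/-- `f` is a phase on `(a, ∞)`: it has positive derivative `f₁`, whose logarithmic derivative `p`
has derivative `p₁`. -/
structure IsPhase (a : ℝ) (f f₁ p p₁ : ℝ → ℝ) : Prop where
  pos : ∀ x, a < x → 0 < f₁ x
  hasDerivAt : ∀ x, a < x → HasDerivAt f (f₁ x) x
  hasDerivAt_deriv : ∀ x, a < x → HasDerivAt f₁ (f₁ x * p x) x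
  hasDerivAt_logDeriv : ∀ x, a < x → HasDerivAt p (p₁ x) x

namespace IsPhase

variable {a : ℝ} {f f₁ p p₁ g g₁ q q₁ : ℝ → ℝ}

/-- The amplitude `f₁ ^ (-1/2)` attached to the phase derivative `f₁`. -/
noncomputable def amplitude (f₁ : ℝ → ℝ) (x : ℝ) : ℝ := exp (-(log (f₁ x) / 2))

/-- The solution `sin (f - c) / √f₁` of Liouville's equation. -/
noncomputable def solution (f f₁ : ℝ → ℝ) (c x : ℝ) : ℝ := sin (f x - c) * amplitude f₁ x

/-- The derivative of `solution`. -/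
noncomputable def solutionDeriv (f f₁ p : ℝ → ℝ) (c x : ℝ) : ℝ :=
  cos (f x - c) * f₁ x * amplitude f₁ x - p x / 2 * solution f f₁ c x

theorem amplitude_pos (f₁ : ℝ → ℝ) (x : ℝ) : 0 < amplitude f₁ x := exp_pos _

theorem hasDerivAt_amplitude (h : IsPhase a f f₁ p p₁) {x : ℝ} (hx : a < x) :
    HasDerivAt (amplitude f₁) (-(p x / 2) * amplitude f₁ x) x := by
  have h0 := (h.pos x hx).ne'
  refine ((((h.hasDerivAt_deriv x hx).log h0).div_const 2).neg.exp).congr_deriv ?_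
  simp only [amplitude, Pi.neg_apply]
  field_simp

theorem hasDerivAt_solution (h : IsPhase a f f₁ p p₁) (c : ℝ) {x : ℝ} (hx : a < x) :
    HasDerivAt (solution f f₁ c) (solutionDeriv f f₁ p c x) x := by
  refine (((h.hasDerivAt x hx).sub_const c).sin.mul (h.hasDerivAt_amplitude hx)).congr_deriv ?_
  unfold solutionDeriv solution
  ring

theorem hasDerivAt_solutionDeriv (h : IsPhase a f f₁ p p₁) (c : ℝ) {x : ℝ} (hx : a < x) :
    HasDerivAt (solutionDeriv f f₁ p c)
      (-(f₁ x ^ 2 + p₁ x / 2 - p x ^ 2 / 4) * solution f f₁ c x) x := by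
  refine (((((h.hasDerivAt x hx).sub_const c).cos.mul (h.hasDerivAt_deriv x hx)).mul
    (h.hasDerivAt_amplitude hx)).sub (((h.hasDerivAt_logDeriv x hx).div_const 2).mul
      (h.hasDerivAt_solution c hx))).congr_deriv ?_
  unfold solutionDeriv solution
  simp only [Pi.mul_apply]
  ring

theorem strictMonoOn (h : IsPhase a f f₁ p p₁) : StrictMonoOn f (Ioi a) := by
  refine strictMonoOn_of_deriv_pos (convex_Ioi a)
    (fun x hx => (h.hasDerivAt x hx).continuousAt.continuousWithinAt) fun x hx => ?_
  rw [interior_Ioi] at hx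
  rw [(h.hasDerivAt x hx).deriv]
  exact h.pos x hx

/-- Sturm comparison for phases: if the potential of `f` exceeds that of `g`, then `f` increases
by more than `π` over any interval on which `g` increases by exactly `π`. -/
theorem pi_lt_sub (hf : IsPhase a f f₁ p p₁) (hg : IsPhase a g g₁ q q₁)
    (hV : ∀ x, a < x →
      g₁ x ^ 2 + q₁ x / 2 - q x ^ 2 / 4 < f₁ x ^ 2 + p₁ x / 2 - p x ^ 2 / 4)
    {x y : ℝ} (hx : a < x) (hxy : x < y) (hgxy : g y = g x + π) : π < f y - f x := by
  by_contra! hle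
  let u := solution g g₁ (g x)
  let v := solution f f₁ (f x)
  let u' := solutionDeriv g g₁ q (g x)
  let v' := solutionDeriv f f₁ p (f x)
  have hW : ∀ z, a < z → HasDerivAt (fun z => u' z * v z - u z * v' z)
      ((f₁ z ^ 2 + p₁ z / 2 - p z ^ 2 / 4 - (g₁ z ^ 2 + q₁ z / 2 - q z ^ 2 / 4))
        * (u z * v z)) z := fun z hz => by
    refine (((hg.hasDerivAt_solutionDeriv (g x) hz).mul (hf.hasDerivAt_solution (f x) hz)).sub
      ((hg.hasDerivAt_solution (g x) hz).mul
        (hf.hasDerivAt_solutionDeriv (f x) hz))).congr_deriv ?_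
    simp only [u, v]
    ring
  have hy := hx.trans hxy
  have hmono : StrictMonoOn (fun z => u' z * v z - u z * v' z) (Icc x y) := by
    refine strictMonoOn_of_deriv_pos (convex_Icc x y)
      (fun z hz => (hW z (hx.trans_le hz.1)).continuousAt.continuousWithinAt) fun z hz => ?_
    rw [interior_Icc] at hz
    have hz' := hx.trans hz.1
    rw [(hW z hz').deriv]
    have h1 := hf.strictMonoOn hx hz' hz.1
    have h2 := hf.strictMonoOn hz' hy hz.2
    have h3 := hg.strictMonoOn hx hz' hz.1
    have h4 := hg.strictMonoOn hz' hy hz.2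
    refine mul_pos (sub_pos.2 (hV z hz')) (mul_pos (mul_pos (sin_pos_of_pos_of_lt_pi ?_ ?_)
      (amplitude_pos _ _)) (mul_pos (sin_pos_of_pos_of_lt_pi ?_ ?_) (amplitude_pos _ _))) <;>
    linarith
  have hlt := hmono (left_mem_Icc.2 hxy.le) (right_mem_Icc.2 hxy.le) hxy
  have hv : 0 ≤ v y := mul_nonneg (sin_nonneg_of_nonneg_of_le_pi
    (sub_nonneg.2 (hf.strictMonoOn hx hy hxy).le) hle) (amplitude_pos _ _).le
  have hc : 0 < g₁ y * amplitude g₁ y := mul_pos (hg.pos y hy) (amplitude_pos _ _)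
  have hvx : v x = 0 := by simp [v, solution]
  have hux : u x = 0 := by simp [u, solution]
  have huy : u y = 0 := by simp [u, solution, hgxy]
  have huy' : u' y = -(g₁ y * amplitude g₁ y) := by
    simp [u', solutionDeriv, solution, hgxy]
  simp only [hvx, hux, huy, huy', mul_zero, zero_mul, sub_zero] at hlt
  nlinarith [mul_nonneg hc.le hv]

/-- Of two phases with the same asymptotics at infinity, the one with the larger potential is
the smaller one. -/
theorem lt_of_potential_lt (hf : IsPhase a f f₁ p p₁) (hg : IsPhase a g g₁ q q₁)
    (hV : ∀ x, a < x →
      g₁ x ^ 2 + q₁ x / 2 - q x ^ 2 / 4 < f₁ x ^ 2 + p₁ x / 2 - p x ^ 2 / 4)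
    {c : ℝ} (hfc : Tendsto (fun x => f x - x) atTop (𝓝 c))
    (hgc : Tendsto (fun x => g x - x) atTop (𝓝 c)) {x : ℝ} (hx : a < x) : f x < g x := by
  by_contra! hle
  have hg_top : Tendsto g atTop atTop := by
    simpa using hgc.add_atTop tendsto_id
  have step : ∀ y, a < y → ∃ z, y < z ∧ g z = g y + π ∧ f y - g y < f z - g z := fun y hy => by
    obtain ⟨b, hyb, hgb⟩ :=
      ((eventually_ge_atTop y).and (hg_top.eventually_ge_atTop (g y + π))).exists
    obtain ⟨z, hz, hgz⟩ := intermediate_value_Icc hyb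
      (fun z hz => (hg.hasDerivAt z (hy.trans_le hz.1)).continuousAt.continuousWithinAt)
      (show g y + π ∈ Icc (g y) (g b) from ⟨by linarith [pi_pos], hgb⟩)
    have hyz : y < z := lt_of_le_of_ne hz.1 fun h => by
      subst h; linarith [pi_pos]
    exact ⟨z, hyz, hgz, by linarith [hf.pi_lt_sub hg hV hy hyz hgz]⟩
  obtain ⟨y, hxy, -, hy⟩ := step x hx
  have hay := hx.trans hxy
  have iter : ∀ n : ℕ, ∃ z, a < z ∧ g z = g y + n * π ∧ f y - g y ≤ f z - g z := fun n => by
    induction n with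
    | zero => exact ⟨y, hay, by simp, le_rfl⟩
    | succ n ih =>
      obtain ⟨z, hz, hgz, hfz⟩ := ih
      obtain ⟨w, hzw, hgw, hfw⟩ := step z hz
      exact ⟨w, hz.trans hzw, by rw [hgw, hgz]; push_cast; ring, hfz.trans hfw.le⟩
  have hlim : Tendsto (fun x => f x - g x) atTop (𝓝 0) := by
    simpa using hfc.sub hgc
  obtain ⟨b, hb⟩ := eventually_atTop.1
    (hlim.eventually_lt_const (show 0 < f y - g y by linarith))
  obtain ⟨n, hn⟩ := exists_nat_gt ((g (max b y) - g y) / π)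
  rw [div_lt_iff₀ pi_pos] at hn
  obtain ⟨z, hz, hgz, hfz⟩ := iter n
  have hbz : max b y < z :=
    (hg.strictMonoOn.lt_iff_lt (hay.trans_le (le_max_right b y)) hz).1 (by linarith)
  exact absurd (hb z ((le_max_left b y).trans hbz.le)) hfz.not_gt

/-- A `C³` function on `(0, ∞)` with positive derivative is a phase. -/
theorem of_contDiffOn {θ : ℝ → ℝ} (hθ : ContDiffOn ℝ 3 θ (Ioi 0))
    (hθ' : ∀ x, 0 < x → 0 < deriv θ x) {a : ℝ} (ha : 0 ≤ a) :
    IsPhase a θ (deriv θ) (fun x => deriv (deriv θ) x / deriv θ x)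
      (fun x => (deriv (deriv (deriv θ)) x * deriv θ x - deriv (deriv θ) x * deriv (deriv θ) x)
        / deriv θ x ^ 2) := by
  have h1 : ContDiffOn ℝ 2 (deriv θ) (Ioi 0) := hθ.deriv_of_isOpen isOpen_Ioi (by norm_num)
  have h2 : ContDiffOn ℝ 1 (deriv (deriv θ)) (Ioi 0) :=
    h1.deriv_of_isOpen isOpen_Ioi (by norm_num)
  have key : ∀ {n : WithTop ℕ∞} {f : ℝ → ℝ}, ContDiffOn ℝ n f (Ioi 0) → n ≠ 0 → ∀ x, a < x →
      HasDerivAt f (deriv f x) x := fun hf hn x hx =>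
    ((hf.differentiableOn hn).differentiableAt (Ioi_mem_nhds (ha.trans_lt hx))).hasDerivAt
  have hne : ∀ x, a < x → deriv θ x ≠ 0 := fun x hx => (hθ' x (ha.trans_lt hx)).ne'
  refine ⟨fun x hx => hθ' x (ha.trans_lt hx), key hθ (by norm_num), fun x hx => ?_, fun x hx =>
    (key h2 (by norm_num) x hx).div (key h1 (by norm_num) x hx) (hne x hx)⟩
  rw [mul_div_cancel₀ _ (hne x hx)]
  exact key h1 (by norm_num) x hx

end IsPhase

theorem potential_eq (θ : ℝ → ℝ) {x : ℝ} (hx : deriv θ x ≠ 0) :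
    deriv θ x ^ 2 + (deriv (deriv (deriv θ)) x * deriv θ x
      - deriv (deriv θ) x * deriv (deriv θ) x) / deriv θ x ^ 2 / 2
      - (deriv (deriv θ) x / deriv θ x) ^ 2 / 4 = potential θ x := by
  unfold potential
  field_simp
  ring

theorem hasDerivAt_sqrt_sq_sub_sq {ν x : ℝ} (h : 0 < x ^ 2 - ν ^ 2) :
    HasDerivAt (fun y => √(y ^ 2 - ν ^ 2)) (x / √(x ^ 2 - ν ^ 2)) x := by
  refine (((hasDerivAt_pow 2 x).sub_const (ν ^ 2)).sqrt h.ne').congr_deriv ?_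
  field_simp
  norm_num

theorem hasDerivAt_thetaUp {ν x : ℝ} (hν : 0 ≤ ν) (hx : ν < x) :
    HasDerivAt (thetaUp ν) (√(x ^ 2 - ν ^ 2) / x) x := by
  have hx0 : 0 < x := hν.trans_lt hx
  have ht : 0 < x ^ 2 - ν ^ 2 := by nlinarith
  have hs : 0 < √(x ^ 2 - ν ^ 2) := sqrt_pos.2 ht
  have hs2 : √(x ^ 2 - ν ^ 2) ^ 2 = x ^ 2 - ν ^ 2 := sq_sqrt ht.le
  have hlt : ν / x < 1 := (div_lt_one hx0).2 hx
  have hge : 0 ≤ ν / x := div_nonneg hν hx0.le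
  have h1 : HasDerivAt (fun y => ν / y) (-ν / x ^ 2) x := by
    refine ((hasDerivAt_const x ν).div (hasDerivAt_id x) hx0.ne').congr_deriv ?_
    simp
  have hsq : √(1 - (ν / x) ^ 2) = √(x ^ 2 - ν ^ 2) / x := by
    nth_rewrite 3 [← sqrt_sq hx0.le]
    rw [← sqrt_div ht.le]
    congr 1
    field_simp
  have h2 := (hasDerivAt_arccos (by linarith) hlt.ne).comp x h1
  refine (((hasDerivAt_sqrt_sq_sub_sq ht).sub (h2.const_mul ν)).sub_const (π / 4)).congr_deriv ?_
  rw [hsq]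
  field_simp
  linarith

theorem hasDerivAt_thetaUp_deriv {ν x : ℝ} (hν : 0 ≤ ν) (hx : ν < x) :
    HasDerivAt (fun y => √(y ^ 2 - ν ^ 2) / y)
      (√(x ^ 2 - ν ^ 2) / x * (ν ^ 2 / (x * (x ^ 2 - ν ^ 2)))) x := by
  have hx0 : 0 < x := hν.trans_lt hx
  have ht : 0 < x ^ 2 - ν ^ 2 := by nlinarith
  have hs : 0 < √(x ^ 2 - ν ^ 2) := sqrt_pos.2 ht
  have hs2 : √(x ^ 2 - ν ^ 2) ^ 2 = x ^ 2 - ν ^ 2 := sq_sqrt ht.le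
  refine ((hasDerivAt_sqrt_sq_sub_sq ht).div (hasDerivAt_id x) hx0.ne').congr_deriv ?_
  simp only [id]
  generalize √(x ^ 2 - ν ^ 2) = s at *
  rw [← hs2]
  field_simp
  linarith

theorem hasDerivAt_thetaUp_logDeriv {ν x : ℝ} (hν : 0 ≤ ν) (hx : ν < x) :
    HasDerivAt (fun y => ν ^ 2 / (y * (y ^ 2 - ν ^ 2)))
      (-(ν ^ 2 * (3 * x ^ 2 - ν ^ 2)) / (x * (x ^ 2 - ν ^ 2)) ^ 2) x := by
  have hx0 : 0 < x := hν.trans_lt hx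
  have ht : 0 < x ^ 2 - ν ^ 2 := by nlinarith
  refine ((hasDerivAt_const x (ν ^ 2)).div ((hasDerivAt_id x).mul
    ((hasDerivAt_pow 2 x).sub_const (ν ^ 2))) (mul_pos hx0 ht).ne').congr_deriv ?_
  simp only [Pi.mul_apply, id]
  push_cast
  congr 1
  ring

theorem isPhase_thetaUp {ν : ℝ} (hν : 0 ≤ ν) :
    IsPhase ν (thetaUp ν) (fun x => √(x ^ 2 - ν ^ 2) / x)
      (fun x => ν ^ 2 / (x * (x ^ 2 - ν ^ 2)))
      (fun x => -(ν ^ 2 * (3 * x ^ 2 - ν ^ 2)) / (x * (x ^ 2 - ν ^ 2)) ^ 2) :=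
  ⟨fun x hx => div_pos (sqrt_pos.2 (by nlinarith)) (hν.trans_lt hx),
    fun _ hx => hasDerivAt_thetaUp hν hx, fun _ hx => hasDerivAt_thetaUp_deriv hν hx,
    fun _ hx => hasDerivAt_thetaUp_logDeriv hν hx⟩

theorem thetaUp_potential_lt {ν x : ℝ} (hν : 0 ≤ ν) (hx : ν < x) :
    (√(x ^ 2 - ν ^ 2) / x) ^ 2 + -(ν ^ 2 * (3 * x ^ 2 - ν ^ 2)) / (x * (x ^ 2 - ν ^ 2)) ^ 2 / 2
      - (ν ^ 2 / (x * (x ^ 2 - ν ^ 2))) ^ 2 / 4 < 1 - (ν ^ 2 - 1 / 4) / x ^ 2 := by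
  have hx0 : 0 < x := hν.trans_lt hx
  have ht : 0 < x ^ 2 - ν ^ 2 := by nlinarith
  rw [div_pow, sq_sqrt ht.le, ← sub_pos]
  have : 1 - (ν ^ 2 - 1 / 4) / x ^ 2 - ((x ^ 2 - ν ^ 2) / x ^ 2
      + -(ν ^ 2 * (3 * x ^ 2 - ν ^ 2)) / (x * (x ^ 2 - ν ^ 2)) ^ 2 / 2
      - (ν ^ 2 / (x * (x ^ 2 - ν ^ 2))) ^ 2 / 4)
      = (x ^ 2 + 4 * ν ^ 2) / (4 * (x ^ 2 - ν ^ 2) ^ 2) := by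
    field_simp
    ring
  rw [this]
  positivity

/-- Up to the factor `8 t ^ 3`, the quotient of the derivatives of `thetaLo ν` and `thetaUp ν`,
with `n = ν ^ 2` and `t = x ^ 2 - ν ^ 2`. -/
noncomputable def loQuot (n t : ℝ) : ℝ := 8 * t ^ 3 + (t + n) * (t + 5 * n)

/-- The logarithmic derivative of `loQuot n t / (8 t ^ 3)` with respect to `t`. -/
noncomputable def loLog (n t : ℝ) : ℝ := -(t ^ 2 + 12 * n * t + 15 * n ^ 2) / (t * loQuot n t)

/-- The derivative of `loLog n`. -/
noncomputable def loLogDeriv (n t : ℝ) : ℝ :=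
  (-(2 * t + 12 * n) * (t * loQuot n t) + (t ^ 2 + 12 * n * t + 15 * n ^ 2)
    * (loQuot n t + t * (24 * t ^ 2 + 2 * t + 6 * n))) / (t * loQuot n t) ^ 2

theorem loQuot_pos {n t : ℝ} (hn : 0 ≤ n) (ht : 0 < t) : 0 < loQuot n t := by
  unfold loQuot
  positivity

theorem hasDerivAt_loQuot (n t : ℝ) :
    HasDerivAt (loQuot n) (24 * t ^ 2 + 2 * t + 6 * n) t := by
  refine (((hasDerivAt_pow 3 t).const_mul 8).add (((hasDerivAt_id t).add_const n).mul
    ((hasDerivAt_id t).add_const (5 * n)))).congr_deriv ?_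
  simp only [id]
  push_cast
  ring

theorem hasDerivAt_loQuot_div {n t : ℝ} (hn : 0 ≤ n) (ht : 0 < t) :
    HasDerivAt (fun t => loQuot n t / (8 * t ^ 3))
      (loQuot n t / (8 * t ^ 3) * loLog n t) t := by
  have hP := loQuot_pos hn ht
  refine ((hasDerivAt_loQuot n t).div ((hasDerivAt_pow 3 t).const_mul 8)
    (by positivity)).congr_deriv ?_
  unfold loLog
  field_simp
  unfold loQuot
  push_cast
  ring

theorem hasDerivAt_loLog {n t : ℝ} (hn : 0 ≤ n) (ht : 0 < t) :
    HasDerivAt (loLog n) (loLogDeriv n t) t := by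
  have hP := loQuot_pos hn ht
  refine (((((hasDerivAt_pow 2 t).add ((hasDerivAt_id t).const_mul (12 * n))).add_const
    (15 * n ^ 2)).neg).div ((hasDerivAt_id t).mul (hasDerivAt_loQuot n t))
    (mul_pos ht hP).ne').congr_deriv ?_
  simp only [Pi.mul_apply, Pi.neg_apply, Pi.add_apply, id]
  unfold loLogDeriv
  congr 1
  push_cast
  ring

theorem hasDerivAt_thetaLo {ν x : ℝ} (hν : 0 ≤ ν) (hx : ν < x) :
    HasDerivAt (thetaLo ν) (√(x ^ 2 - ν ^ 2) / x *
      (loQuot (ν ^ 2) (x ^ 2 - ν ^ 2) / (8 * (x ^ 2 - ν ^ 2) ^ 3))) x := by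
  have hx0 : 0 < x := hν.trans_lt hx
  have ht : 0 < x ^ 2 - ν ^ 2 := by nlinarith
  have hs : 0 < √(x ^ 2 - ν ^ 2) := sqrt_pos.2 ht
  have hs2 : √(x ^ 2 - ν ^ 2) ^ 2 = x ^ 2 - ν ^ 2 := sq_sqrt ht.le
  have hq := hasDerivAt_sqrt_sq_sub_sq ht
  refine ((hasDerivAt_thetaUp hν hx).sub (((((hasDerivAt_pow 2 x).const_mul 3).add_const
    (2 * ν ^ 2)).div ((hq.pow 3).const_mul 24) (mul_pos (by norm_num) (pow_pos hs 3)).ne'))).congr_deriv ?_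
  simp only [Pi.pow_apply]
  unfold loQuot
  push_cast
  generalize √(x ^ 2 - ν ^ 2) = s at *
  rw [← hs2]
  have hn : ν ^ 2 = x ^ 2 - s ^ 2 := by linarith
  rw [hn]
  field_simp
  ring

theorem isPhase_thetaLo {ν : ℝ} (hν : 0 ≤ ν) :
    IsPhase ν (thetaLo ν)
      (fun x => √(x ^ 2 - ν ^ 2) / x *
        (loQuot (ν ^ 2) (x ^ 2 - ν ^ 2) / (8 * (x ^ 2 - ν ^ 2) ^ 3)))
      (fun x => ν ^ 2 / (x * (x ^ 2 - ν ^ 2)) + loLog (ν ^ 2) (x ^ 2 - ν ^ 2) * (2 * x))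
      (fun x => -(ν ^ 2 * (3 * x ^ 2 - ν ^ 2)) / (x * (x ^ 2 - ν ^ 2)) ^ 2
        + (loLogDeriv (ν ^ 2) (x ^ 2 - ν ^ 2) * (2 * x) * (2 * x)
          + loLog (ν ^ 2) (x ^ 2 - ν ^ 2) * 2)) := by
  have ht : ∀ x, ν < x → 0 < x ^ 2 - ν ^ 2 := fun x hx => by nlinarith
  have hn : 0 ≤ ν ^ 2 := sq_nonneg ν
  have hd : ∀ x, HasDerivAt (fun y => y ^ 2 - ν ^ 2) (2 * x) x := fun x => by
    simpa using (hasDerivAt_pow 2 x).sub_const (ν ^ 2)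
  refine ⟨fun x hx => mul_pos ((isPhase_thetaUp hν).pos x hx)
    (div_pos (loQuot_pos hn (ht x hx)) (mul_pos (by norm_num) (pow_pos (ht x hx) 3))),
    fun _ hx => hasDerivAt_thetaLo hν hx, fun x hx => ?_, fun x hx => ?_⟩
  · refine ((hasDerivAt_thetaUp_deriv hν hx).mul
      (HasDerivAt.comp x (hasDerivAt_loQuot_div hn (ht x hx)) (hd x))).congr_deriv ?_
    simp only [Function.comp_apply]
    ring
  · have h2 : HasDerivAt (fun y : ℝ => 2 * y) 2 x := by
      simpa using (hasDerivAt_id x).const_mul 2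
    exact (hasDerivAt_thetaUp_logDeriv hν hx).add
      ((HasDerivAt.comp x (hasDerivAt_loLog hn (ht x hx)) (hd x)).mul h2)

/-- The numerator of the difference between the potential of `thetaLo ν` and that of a Bessel
phase, with `n = ν ^ 2` and `t = x ^ 2 - ν ^ 2`. -/
noncomputable def loExcess (n t : ℝ) : ℝ :=
  625 * n ^ 7 + 2375 * t * n ^ 6 + 3525 * t ^ 2 * n ^ 5 + 2595 * t ^ 3 * n ^ 4
    + 2000 * t ^ 3 * n ^ 5 + 1011 * t ^ 4 * n ^ 3 + 5200 * t ^ 4 * n ^ 4 + 213 * t ^ 5 * n ^ 2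
    + 4128 * t ^ 5 * n ^ 3 + 23 * t ^ 6 * n + 1696 * t ^ 6 * n ^ 2 + 70720 * t ^ 6 * n ^ 3
    + t ^ 7 + 784 * t ^ 7 * n + 99008 * t ^ 7 * n ^ 2 + 16 * t ^ 8
    + 33984 * t ^ 8 * n + 1600 * t ^ 9

theorem loExcess_pos {n t : ℝ} (hn : 0 ≤ n) (ht : 0 < t) : 0 < loExcess n t := by
  unfold loExcess
  positivity

theorem lt_thetaLo_potential {ν x : ℝ} (hν : 0 ≤ ν) (hx : ν < x) :
    1 - (ν ^ 2 - 1 / 4) / x ^ 2 <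
      (√(x ^ 2 - ν ^ 2) / x *
        (loQuot (ν ^ 2) (x ^ 2 - ν ^ 2) / (8 * (x ^ 2 - ν ^ 2) ^ 3))) ^ 2
      + (-(ν ^ 2 * (3 * x ^ 2 - ν ^ 2)) / (x * (x ^ 2 - ν ^ 2)) ^ 2
        + (loLogDeriv (ν ^ 2) (x ^ 2 - ν ^ 2) * (2 * x) * (2 * x)
          + loLog (ν ^ 2) (x ^ 2 - ν ^ 2) * 2)) / 2
      - (ν ^ 2 / (x * (x ^ 2 - ν ^ 2)) + loLog (ν ^ 2) (x ^ 2 - ν ^ 2) * (2 * x)) ^ 2 / 4 := by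
  have hx0 : 0 < x := hν.trans_lt hx
  have ht : 0 < x ^ 2 - ν ^ 2 := by nlinarith
  have hn : 0 ≤ ν ^ 2 := sq_nonneg ν
  rw [mul_pow, div_pow, sq_sqrt ht.le, ← sub_pos]
  generalize hs : x ^ 2 - ν ^ 2 = t at *
  generalize ν ^ 2 = n at *
  have hP := loQuot_pos hn ht
  obtain rfl : n = x ^ 2 - t := by linarith
  have : t / x ^ 2 * (loQuot (x ^ 2 - t) t / (8 * t ^ 3)) ^ 2
      + (-((x ^ 2 - t) * (3 * x ^ 2 - (x ^ 2 - t))) / (x * t) ^ 2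
        + (loLogDeriv (x ^ 2 - t) t * (2 * x) * (2 * x) + loLog (x ^ 2 - t) t * 2)) / 2
      - ((x ^ 2 - t) / (x * t) + loLog (x ^ 2 - t) t * (2 * x)) ^ 2 / 4
      - (1 - (x ^ 2 - t - 1 / 4) / x ^ 2) =
      loExcess (x ^ 2 - t) t / (64 * t ^ 5 * loQuot (x ^ 2 - t) t ^ 2) := by
    unfold loLog loLogDeriv
    field_simp
    unfold loQuot loExcess
    ring
  rw [this]
  have hE := loExcess_pos hn ht
  positivity

theorem tendsto_sqrt_sq_sub_sq (ν : ℝ) :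
    Tendsto (fun x => √(x ^ 2 - ν ^ 2)) atTop atTop :=
  tendsto_sqrt_atTop.comp
    (tendsto_atTop_add_const_right _ (-ν ^ 2) (tendsto_pow_atTop two_ne_zero))

theorem tendsto_thetaUp_sub {ν : ℝ} :
    Tendsto (fun x => thetaUp ν x - x) atTop (𝓝 (-(π / 4 * (2 * ν + 1)))) := by
  have h1 : Tendsto (fun x => √(x ^ 2 - ν ^ 2) - x) atTop (𝓝 0) := by
    have h : Tendsto (fun x => -ν ^ 2 / (√(x ^ 2 - ν ^ 2) + x)) atTop (𝓝 0) :=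
      tendsto_const_nhds.div_atTop ((tendsto_sqrt_sq_sub_sq ν).atTop_add_atTop tendsto_id)
    refine h.congr' ?_
    filter_upwards [eventually_gt_atTop |ν|] with x hx
    have hx0 : 0 < x := (abs_nonneg ν).trans_lt hx
    have ht : 0 ≤ x ^ 2 - ν ^ 2 := sub_nonneg.2 (sq_le_sq.2 (hx.le.trans (le_abs_self x)))
    have hne : √(x ^ 2 - ν ^ 2) + x ≠ 0 := by positivity
    rw [div_eq_iff hne]
    linarith [sq_sqrt ht]
  have h2 : Tendsto (fun x => arccos (ν / x)) atTop (𝓝 (π / 2)) := by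
    rw [← arccos_zero]
    exact (continuous_arccos.tendsto 0).comp (tendsto_const_nhds.div_atTop tendsto_id)
  convert (h1.sub (h2.const_mul ν)).sub_const (π / 4) using 2
  · unfold thetaUp
    ring
  · ring

theorem tendsto_thetaLo_sub {ν : ℝ} :
    Tendsto (fun x => thetaLo ν x - x) atTop (𝓝 (-(π / 4 * (2 * ν + 1)))) := by
  have hs := tendsto_sqrt_sq_sub_sq ν
  have h1 : Tendsto (fun x => 1 / 8 / √(x ^ 2 - ν ^ 2)
      + 5 * ν ^ 2 / 24 / √(x ^ 2 - ν ^ 2) ^ 3) atTop (𝓝 (0 + 0)) :=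
    (tendsto_const_nhds.div_atTop hs).add
      (tendsto_const_nhds.div_atTop ((tendsto_pow_atTop three_ne_zero).comp hs))
  have h2 := tendsto_thetaUp_sub (ν := ν).sub h1
  simp only [add_zero, sub_zero] at h2
  refine h2.congr' ?_
  filter_upwards [hs.eventually_gt_atTop 0] with x hx
  have hs2 := sq_sqrt (sqrt_pos.1 hx).le
  unfold thetaLo
  rw [show 3 * x ^ 2 + 2 * ν ^ 2 = 3 * √(x ^ 2 - ν ^ 2) ^ 2 + 5 * ν ^ 2 by rw [hs2]; ring]
  field_simp
  ring

theorem tendsto_sub_of_isBigO {θ : ℝ → ℝ} {c A B : ℝ}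
    (h : Asymptotics.IsBigO atTop
      (fun x : ℝ => θ x - (x - c + A / (8 * x) + B / (384 * x ^ 3)))
      (fun x : ℝ => 1 / x ^ 5)) :
    Tendsto (fun x => θ x - x) atTop (𝓝 (-c)) := by
  have h0 := h.trans_tendsto
    (tendsto_const_nhds.div_atTop (tendsto_pow_atTop (n := 5) (by norm_num)))
  have h1 : Tendsto (fun x : ℝ => A / (8 * x)) atTop (𝓝 0) :=
    tendsto_const_nhds.div_atTop (tendsto_id.const_mul_atTop (by norm_num))
  have h2 : Tendsto (fun x : ℝ => B / (384 * x ^ 3)) atTop (𝓝 0) :=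
    tendsto_const_nhds.div_atTop
      ((tendsto_pow_atTop three_ne_zero).const_mul_atTop (by norm_num))
  convert ((h0.add h1).add h2).sub_const c using 2
  · ring
  · ring

/-- Uniform two-sided bounds for the Bessel phase function: any function `θ` satisfying the
defining properties of the Bessel phase function `θ_ν` is squeezed between
`max{θlo_ν, −π/2}` and `θup_ν` on `(ν, ∞)`. -/
theorem bessel_phase_bounds (ν : ℝ) (hν : 0 ≤ ν) (θ : ℝ → ℝ)
    (hθ : ContDiffOn ℝ 3 θ (Set.Ioi 0))
    (hθ' : ∀ x, 0 < x → 0 < deriv θ x)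
    (hθlb : ∀ x, 0 < x → -(Real.pi / 2) < θ x)
    (hV : ∀ x, 0 < x → potential θ x = 1 - (ν ^ 2 - 1 / 4) / x ^ 2)
    (hasymp : Asymptotics.IsBigO Filter.atTop
      (fun x : ℝ => θ x - (x - (Real.pi / 4) * (2 * ν + 1) + (4 * ν ^ 2 - 1) / (8 * x)
        + (4 * ν ^ 2 - 1) * (4 * ν ^ 2 - 25) / (384 * x ^ 3)))
      (fun x : ℝ => 1 / x ^ 5)) :
    ∀ x, ν < x → max (thetaLo ν x) (-(Real.pi / 2)) < θ x ∧ θ x < thetaUp ν x := by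
  intro x hx
  have hx0 : ∀ y, ν < y → 0 < y := fun y hy => hν.trans_lt hy
  have hph := IsPhase.of_contDiffOn hθ hθ' hν
  have hpot : ∀ y, ν < y → _ := fun y hy =>
    (potential_eq θ (hθ' y (hx0 y hy)).ne').trans (hV y (hx0 y hy))
  have hlim := tendsto_sub_of_isBigO hasymp
  refine ⟨max_lt ?_ (hθlb x (hx0 x hx)), ?_⟩
  · refine (isPhase_thetaLo hν).lt_of_potential_lt hph (fun y hy => ?_)
      tendsto_thetaLo_sub hlim hx
    exact (hpot y hy).trans_lt (lt_thetaLo_potential hν hy)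
  · refine hph.lt_of_potential_lt (isPhase_thetaUp hν) (fun y hy => ?_)
      hlim tendsto_thetaUp_sub hx
    exact (thetaUp_potential_lt hν hy).trans_eq (hpot y hy).symm
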